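/- arXiv:1402.6673 — 2 statements merged into one kernel-verified Lean document; each statement's English description precedes it below -/
import Mathlib

section
/- Every qualgebra (Q, ⊲, ⊲̃, ⋄) whose underlying set has exactly 4 elements and in which ⊲ is non-trivial (i.e., a ⊲ b ≠ a for some a,b) is isomorphic to the structure (P, ⊲, ⋄) for some choice of parameters u, v ∈ {p, q, s}; here an isomorphism is a bijection f : Q → P with f(x ⊲ y) = f(x) ⊲ f(y) and f(x ⋄ y) = f(x) ⋄ f(y) for all x, y. -/
/-- The 4-element set `P = {p, q, r, s}`. -/
inductive P4 : Type
  | p | q | r | s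
  deriving DecidableEq

/-- The involution `τ` of `P` exchanging `p` and `q` and fixing `r` and `s`. -/
def tau : P4 → P4
  | .p => .q
  | .q => .p
  | .r => .r
  | .s => .s

/-- The quandle operation `⊲` on `P`: `x ⊲ r = τ(x)`, and `x ⊲ y = x` for `y ≠ r`. -/
def triP : P4 → P4 → P4
  | x, .r => tau x
  | x, _ => x

/-- The qualgebra operation `⋄` on `P` with parameters `u, v ∈ {p, q, s}`. -/
def diaP (u v : P4) : P4 → P4 → P4
  | .r, .r => .s
  | .r, _ => .r
  | _, .r => .r
  | .s, .s => .s
  | .q, .s => u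
  | .s, .q => u
  | .p, .s => tau u
  | .s, .p => tau u
  | .p, .q => .s
  | .q, .p => .s
  | .q, .q => v
  | .p, .p => tau v

/-- Three distinct points of a 4-element type are completed by a fourth one to the whole type. -/
theorem exists_fourth_of_card_eq_four {Q : Type*} (hcard : Nat.card Q = 4) {p q r : Q}
    (hpq : p ≠ q) (hpr : p ≠ r) (hqr : q ≠ r) :
    ∃ s, s ≠ p ∧ s ≠ q ∧ s ≠ r ∧ ∀ x, x = p ∨ x = q ∨ x = r ∨ x = s := by
  classical
  have : Finite Q := Nat.finite_of_card_ne_zero (by omega)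
  have := Fintype.ofFinite Q
  rw [Nat.card_eq_fintype_card] at hcard
  have h3 : ({p, q, r} : Finset Q).card = 3 := Finset.card_eq_three.2 ⟨p, q, r, hpq, hpr, hqr, rfl⟩
  have h1 : ({p, q, r} : Finset Q)ᶜ.card = 1 := by rw [Finset.card_compl, hcard, h3]
  obtain ⟨s, hs⟩ := Finset.card_eq_one.1 h1
  have hmem : ∀ x, (x ≠ p ∧ x ≠ q ∧ x ≠ r) ↔ x = s := fun x => by
    simpa using Finset.ext_iff.1 hs x
  obtain ⟨hp, hq, hr⟩ := (hmem s).2 rfl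
  refine ⟨s, hp, hq, hr, fun x => ?_⟩
  have := hmem x
  tauto

/-- The map `P4 → Q` with prescribed values. -/
def P4.lift {Q : Type*} (p q r s : Q) : P4 → Q
  | .p => p
  | .q => q
  | .r => r
  | .s => s

theorem P4.lift_bijective {Q : Type*} {p q r s : Q} (hpq : p ≠ q) (hpr : p ≠ r) (hqr : q ≠ r)
    (hsp : s ≠ p) (hsq : s ≠ q) (hsr : s ≠ r) (hall : ∀ x, x = p ∨ x = q ∨ x = r ∨ x = s) :
    Function.Bijective (P4.lift p q r s) := by
  constructor
  · intro x y h
    cases x <;> cases y <;> simp_all [P4.lift, eq_comm]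
  · intro x
    rcases hall x with rfl | rfl | rfl | rfl
    exacts [⟨.p, rfl⟩, ⟨.q, rfl⟩, ⟨.r, rfl⟩, ⟨.s, rfl⟩]

/-- Every qualgebra with exactly 4 elements whose quandle operation is non-trivial is
isomorphic to `(P, ⊲, ⋄_{u,v})` for some parameters `u, v ∈ {p, q, s}`. -/
theorem qualgebra4_classification {Q : Type*} (hcard : Nat.card Q = 4)
    (tri trid dia : Q → Q → Q)
    (h_sd : ∀ a b c, tri (tri a b) c = tri (tri a c) (tri b c))
    (h_inv : ∀ a b, trid (tri a b) b = a ∧ tri (trid a b) b = a)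
    (h_idem : ∀ a, tri a a = a)
    (h_comp : ∀ a b c, tri a (dia b c) = tri (tri a b) c)
    (h_d : ∀ a b c, tri (dia a b) c = dia (tri a c) (tri b c))
    (h_comm : ∀ a b, dia a b = dia b (tri a b))
    (h_nontrivial : ∃ a b : Q, tri a b ≠ a) :
    ∃ u ∈ ({P4.p, P4.q, P4.s} : Set P4), ∃ v ∈ ({P4.p, P4.q, P4.s} : Set P4),
      ∃ f : Q → P4, Function.Bijective f ∧
        (∀ x y : Q, f (tri x y) = triP (f x) (f y)) ∧
        (∀ x y : Q, f (dia x y) = diaP u v (f x) (f y)) := by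
  obtain ⟨p, r, hp⟩ := h_nontrivial
  have inj : ∀ {a b c}, tri a c = tri b c → a = b := fun {a b c} h => by
    rw [← (h_inv a c).1, h, (h_inv b c).1]
  obtain ⟨q, hq⟩ : ∃ q, tri p r = q := ⟨_, rfl⟩
  rw [hq] at hp
  have hpr : p ≠ r := by
    rintro rfl
    exact hp (hq ▸ h_idem p)
  have hqr : q ≠ r := by
    rintro rfl
    exact hpr (inj (hq.trans (h_idem q).symm))
  obtain ⟨s, hsp, hsq, hsr, hall⟩ := exists_fourth_of_card_eq_four hcard hp.symm hpr hqr
  have hrr : dia r r ≠ r := by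
    intro h
    have := h_comp p r r
    rw [h, hq] at this
    exact hp (inj (hq.trans this)).symm
  have hrr_fixed : tri (dia r r) r = dia r r := by rw [h_d, h_idem]
  -- A square of `r` fixed by `r` and different from `r` rules out a 3-cycle.
  have hrs : dia r r = s := by
    have := hall (dia r r)
    have := @inj q p r
    grind
  have hs : tri s r = s := hrs ▸ hrr_fixed
  have hqp : tri q r = p := by
    have := hall (tri q r)
    have := @inj q p r
    have := @inj q r r
    have := @inj q s r
    grind
  have act_s : ∀ x, tri x s = x := by
    intro x
    rw [← hrs, h_comp]
    rcases hall x with rfl | rfl | rfl | rfl <;> simp only [hq, hqp, hs, h_idem]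
  -- Elements acting trivially are preserved by the action.
  have conj_trivial : ∀ a b, (∀ x, tri x a = x) → ∀ x, tri x (tri a b) = x := by
    intro a b h x
    rw [← (h_inv x b).2, ← h_sd, h]
  have conj_trivial' : ∀ a b, (∀ x, tri x (tri a b) = x) → ∀ x, tri x a = x := by
    intro a b h x
    exact inj ((h_sd x a b).trans (h _))
  have hr_ne : ∀ a, (∀ x, tri x a = x) → a ≠ r := by
    rintro a h rfl
    exact hp (hq ▸ h p)
  -- The translation by `p` fixes `r`: otherwise `dia p q` would act as a 3-cycle fixing `s`.
  have hrp : tri r p = r := by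
    rcases hall (tri r p) with h | h | h | h
    · exact absurd (inj (h.trans (h_idem p).symm)).symm hpr
    · have hsp_ne : tri s p ≠ r := hr_ne _ (conj_trivial s p act_s)
      have hsp' : tri s p = s := by
        have := hall (tri s p)
        have := @inj s r p
        have := @inj s p p
        have := h_idem p
        grind
      have hqp' : tri q p = r := by
        have := hall (tri q p)
        have := @inj q r p
        have := @inj q p p
        have := @inj q s p
        have := h_idem p
        grind
      have hpq' : tri p q = r := by
        have := h_sd q p r
        rwa [hqp', hqp, hq, h_idem, eq_comm] at this
      have hrq' : tri r q = p := by
        have := h_sd r p r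
        rwa [h, hqp, hq, h_idem, eq_comm] at this
      have hsq' : tri s q = s := by
        have := h_sd s p r
        rwa [hsp', hs, hq, eq_comm] at this
      have h1 : tri p (dia p q) = r := by rw [h_comp, h_idem, hpq']
      have h2 : tri q (dia p q) = p := by rw [h_comp, hqp', hrq']
      have h3 : tri r (dia p q) = q := by rw [h_comp, h, h_idem]
      have := h_idem (dia p q)
      have := act_s p
      have := hall (dia p q)
      grind
    · exact h
    · exact absurd rfl (hr_ne r (conj_trivial' r p (h ▸ act_s)))
  have act_p : ∀ x, tri x p = x := by
    have h1 : tri q p = q := by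
      have := h_sd p r p
      rwa [hq, h_idem, hrp, hq] at this
    intro x
    rcases hall x with rfl | rfl | rfl | rfl
    · exact h_idem _
    · exact h1
    · exact hrp
    · have := hall (tri x p)
      have := @inj x r p
      have := @inj x p p
      have := @inj x q p
      have := h_idem p
      grind
  have act_q : ∀ x, tri x q = x := hq ▸ conj_trivial p r act_p
  have eq_r : ∀ x, tri p x = q → x = r := by
    intro x hx
    rcases hall x with rfl | rfl | rfl | rfl
    · exact absurd ((act_p _).symm.trans hx).symm hp
    · exact absurd ((act_q _).symm.trans hx).symm hp
    · rfl
    · exact absurd ((act_s _).symm.trans hx).symm hp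
  have eq_s : ∀ x, x ≠ r → tri x r = x → x = s := by
    intro x hx hxr
    rcases hall x with rfl | rfl | rfl | rfl
    · exact absurd (hq.symm.trans hxr) hp
    · exact absurd (hqp.symm.trans hxr).symm hp
    · exact absurd rfl hx
    · rfl
  have dia_ne : ∀ a b, (∀ x, tri x a = x) → (∀ x, tri x b = x) → dia a b ≠ r :=
    fun a b ha hb => hr_ne _ fun x => by rw [h_comp, ha, hb]
  have dia_comm : ∀ a b, (∀ x, tri x b = x) → dia a b = dia b a := fun a b hb => by
    rw [h_comm, hb]
  have dia_r_left : ∀ a, (∀ x, tri x a = x) → dia r a = r := fun a ha =>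
    eq_r _ (by rw [h_comp, ha, hq])
  have dia_r_right : ∀ a, (∀ x, tri x a = x) → dia a r = r := fun a ha =>
    (dia_comm r a ha).symm.trans (dia_r_left a ha)
  have hss : dia s s = s := eq_s _ (dia_ne s s act_s act_s) (by rw [h_d, hs])
  have hpq : dia p q = s :=
    eq_s _ (dia_ne p q act_p act_q) (by rw [h_d, hq, hqp, dia_comm q p act_p])
  let e : P4 ≃ Q :=
    Equiv.ofBijective (P4.lift p q r s) (P4.lift_bijective hp.symm hpr hqr hsp hsq hsr hall)
  have ep : e .p = p := rfl
  have eq : e .q = q := rfl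
  have er : e .r = r := rfl
  have es : e .s = s := rfl
  have tri_r : ∀ x, tri (e x) r = e (tau x) := by
    intro x
    cases x <;> simp only [ep, eq, er, es, tau, hq, hqp, hs, h_idem]
  have exists_param : ∀ x, x ≠ r → ∃ u ∈ ({P4.p, P4.q, P4.s} : Set P4), e u = x := by
    intro x hx
    rcases hall x with rfl | rfl | rfl | rfl
    exacts [⟨.p, by simp, rfl⟩, ⟨.q, by simp, rfl⟩, absurd rfl hx, ⟨.s, by simp, rfl⟩]
  obtain ⟨u, hu, hqs⟩ := exists_param _ (dia_ne q s act_q act_s)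
  obtain ⟨v, hv, hqq⟩ := exists_param _ (dia_ne q q act_q act_q)
  have hps : dia p s = e (tau u) := by rw [← tri_r, hqs, h_d, hqp, hs]
  have hpp : dia p p = e (tau v) := by rw [← tri_r, hqq, h_d, hqp]
  refine ⟨u, hu, v, hv, e.symm, e.symm.bijective, fun x y => ?_, fun x y => ?_⟩
  · obtain ⟨x, rfl⟩ := e.surjective x
    obtain ⟨y, rfl⟩ := e.surjective y
    rw [Equiv.symm_apply_eq, e.symm_apply_apply, e.symm_apply_apply]
    cases y <;> simp only [ep, eq, er, es, triP, act_p, act_q, act_s, tri_r]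
  · obtain ⟨x, rfl⟩ := e.surjective x
    obtain ⟨y, rfl⟩ := e.surjective y
    rw [Equiv.symm_apply_eq, e.symm_apply_apply, e.symm_apply_apply]
    cases x <;> cases y <;>
      simp only [ep, eq, er, es, diaP, hrs, hss, hpq, hqs, hqq, hps, hpp,
        dia_r_left _ act_p, dia_r_left _ act_q, dia_r_left _ act_s,
        dia_r_right _ act_p, dia_r_right _ act_q, dia_r_right _ act_s,
        dia_comm s p act_p, dia_comm s q act_q, dia_comm q p act_p]
end

section
/- For every choice of parameters u, v ∈ {p, q, s}, the structure (P, ⊲, ⋄) is a qualgebra; moreover, the nine qualgebras obtained from the nine choices of (u, v) are pairwise non-isomorphic: for distinct (u, v) ≠ (u', v') there is no bijection f : P → P with f(x ⊲ y) = f(x) ⊲ f(y) and f(x ⋄_{u,v} y) = f(x) ⋄_{u',v'} f(y) for all x, y. -/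
theorem tau_injective : Function.Injective tau := by
  rintro (_ | _ | _ | _) (_ | _ | _ | _) <;> simp [tau]

theorem eq_r_of_triP_ne {x y : P4} (h : triP x y ≠ x) : y = .r := by
  cases y <;> simp_all [triP]

/-- An injective homomorphism between two of the structures on `P` is the identity or `τ`. -/
theorem eq_id_or_eq_tau {u v u' v' : P4} {f : P4 → P4} (hf : Function.Injective f)
    (htri : ∀ x y, f (triP x y) = triP (f x) (f y))
    (hdia : ∀ x y, f (diaP u v x y) = diaP u' v' (f x) (f y)) : f = id ∨ f = tau := by
  have hr : f .r = .r := eq_r_of_triP_ne (x := f .p) <| by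
    rw [← htri]
    exact hf.ne (by decide)
  have hs : f .s = .s := by simpa [hr, diaP] using hdia .r .r
  have hq : f .q = tau (f .p) := by simpa [hr, triP, tau] using htri .p .r
  cases hp : f .p
  · left
    funext x
    cases x <;> simp [hp, hq, hr, hs, tau]
  · right
    funext x
    cases x <;> simp [hp, hq, hr, hs, tau]
  · exact absurd (hf (hp.trans hr.symm)) (by decide)
  · exact absurd (hf (hp.trans hs.symm)) (by decide)

/-- Isomorphic structures on `P` have the same parameters. -/
theorem params_eq_of_hom {u v u' v' : P4} {f : P4 → P4} (hf : Function.Injective f)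
    (htri : ∀ x y, f (triP x y) = triP (f x) (f y))
    (hdia : ∀ x y, f (diaP u v x y) = diaP u' v' (f x) (f y)) : (u, v) = (u', v') := by
  have hqs := hdia .q .s
  have hqq := hdia .q .q
  rcases eq_id_or_eq_tau hf htri hdia with rfl | rfl
  · exact Prod.ext hqs hqq
  · exact Prod.ext (tau_injective hqs) (tau_injective hqq)

/-- For every choice of parameters `u, v ∈ {p, q, s}`, the structure `(P, ⊲, ⋄_{u,v})`
is a qualgebra (with `⊲̃ = ⊲`), and the resulting nine qualgebras are pairwise
non-isomorphic. -/
theorem qualgebra4_structures :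
    (∀ u ∈ ({P4.p, P4.q, P4.s} : Set P4), ∀ v ∈ ({P4.p, P4.q, P4.s} : Set P4),
      (∀ a b c : P4, triP (triP a b) c = triP (triP a c) (triP b c)) ∧
      (∀ a b : P4, triP (triP a b) b = a) ∧
      (∀ a : P4, triP a a = a) ∧
      (∀ a b c : P4, triP a (diaP u v b c) = triP (triP a b) c) ∧
      (∀ a b c : P4, triP (diaP u v a b) c = diaP u v (triP a c) (triP b c)) ∧
      (∀ a b : P4, diaP u v a b = diaP u v b (triP a b))) ∧
    (∀ u ∈ ({P4.p, P4.q, P4.s} : Set P4), ∀ v ∈ ({P4.p, P4.q, P4.s} : Set P4),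
     ∀ u' ∈ ({P4.p, P4.q, P4.s} : Set P4), ∀ v' ∈ ({P4.p, P4.q, P4.s} : Set P4),
      (u, v) ≠ (u', v') →
      ¬ ∃ f : P4 → P4, Function.Bijective f ∧
          (∀ x y : P4, f (triP x y) = triP (f x) (f y)) ∧
          (∀ x y : P4, f (diaP u v x y) = diaP u' v' (f x) (f y))) := by
  refine ⟨?_, ?_⟩
  · rintro u (rfl | rfl | rfl) v (rfl | rfl | rfl) <;>
      refine ⟨?_, ?_, ?_, ?_, ?_, ?_⟩ <;>
      rintro (_ | _ | _ | _) <;> try rintro (_ | _ | _ | _) <;> try rintro (_ | _ | _ | _)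
    all_goals rfl
  · rintro u - v - u' - v' - hne ⟨f, hf, htri, hdia⟩
    exact hne (params_eq_of_hom hf.injective htri hdia)
end
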